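/- arXiv:2402.08478 — 2 statements merged into one kernel-verified Lean document; each statement's English description precedes it below -/
import Mathlib

section
/- For all γ ∈ (1,∞), β ∈ (0, 8/5], c̃ ∈ (0,∞) and all t ∈ [0,∞), one has φ_{β,β,c̃/γ}(t) ≤ (c̃/γ)·φ_1(t), with equality if and only if t = 1. -/
open scoped BigOperators

noncomputable section

namespace BareSim

/-- The divergence generator `φ_{α,β,c̃}` of Example `brostu5:ex.2` (value `0` at `t = 1`). -/
def phiABC (α β c t : ℝ) : ℝ :=
  if t = 1 then 0
  else
    c * α * (Real.sqrt (1 + β ^ 2 * ((1 - t) / α) ^ 2) - 1 +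
      Real.log (2 * (Real.sqrt (1 + β ^ 2 * ((1 - t) / α) ^ 2) - 1) /
        (β ^ 2 * ((1 - t) / α) ^ 2)))

/-- The Kullback–Leibler generator `φ_1(t) = t·log t + 1 − t` for `t > 0`, with
`φ_1(0) := 1`. -/
def phiOneR (t : ℝ) : ℝ := if t = 0 then 1 else t * Real.log t + 1 - t

/-- The difference between the Kullback–Leibler generator and the simplified form of
`φ_{β,β,1}`. -/
def klGap (β t : ℝ) : ℝ :=
  t * Real.log t + 1 - t -
    β * (Real.sqrt (1 + (1 - t) ^ 2) - 1 - Real.log ((Real.sqrt (1 + (1 - t) ^ 2) + 1) / 2))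

lemma klGap_one (β : ℝ) : klGap β 1 = 0 := by
  norm_num [klGap]

lemma continuous_klGap (β : ℝ) : Continuous (klGap β) := by
  unfold klGap
  have h : Continuous fun t : ℝ => Real.log ((Real.sqrt (1 + (1 - t) ^ 2) + 1) / 2) := by
    refine Continuous.log (by fun_prop) fun t => ?_
    positivity
  have h2 := Real.continuous_mul_log
  fun_prop

lemma hasDerivAt_klGap (β : ℝ) {t : ℝ} (ht : 0 < t) :
    HasDerivAt (klGap β) (Real.log t - β * ((t - 1) / (Real.sqrt (1 + (1 - t) ^ 2) + 1))) t := by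
  have hpos : 0 < 1 + (1 - t) ^ 2 := by positivity
  have hs : 0 < Real.sqrt (1 + (1 - t) ^ 2) := Real.sqrt_pos.2 hpos
  have hq : HasDerivAt (fun t : ℝ => 1 + (1 - t) ^ 2) (2 * (t - 1)) t := by
    refine ((((hasDerivAt_id t).const_sub 1).pow 2).const_add 1).congr_deriv ?_
    simp only [id, Nat.cast_ofNat]
    ring
  have hsq := hq.sqrt hpos.ne'
  have hlog := ((hsq.add_const 1).div_const 2).log (by positivity)
  have hkl := ((Real.hasDerivAt_mul_log ht.ne').add_const 1).sub (hasDerivAt_id t)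
  have h := hkl.sub (((hsq.sub_const 1).sub hlog).const_mul β)
  refine h.congr_deriv ?_
  field_simp
  ring

/-- Since `3/5 + 4/5 u ≤ √(1 + u²)`, the bound `2u / (u + 2) < log (1 + u)` suffices. -/
lemma deriv_klGap_pos {β t : ℝ} (hβ1 : β ≤ 8 / 5) (ht : 1 < t) :
    0 < Real.log t - β * ((t - 1) / (Real.sqrt (1 + (1 - t) ^ 2) + 1)) := by
  have hlog := Real.lt_log_one_add_of_pos (sub_pos.2 ht)
  rw [add_sub_cancel] at hlog
  have hs : 3 / 5 + 4 / 5 * (t - 1) ≤ Real.sqrt (1 + (1 - t) ^ 2) := by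
    apply Real.le_sqrt_of_sq_le
    nlinarith [sq_nonneg (3 * (t - 1) - 4)]
  have hu : 0 < t - 1 := sub_pos.2 ht
  have h0 := Real.sqrt_nonneg (1 + (1 - t) ^ 2)
  have h1 : β * ((t - 1) / (Real.sqrt (1 + (1 - t) ^ 2) + 1)) ≤
      8 / 5 * ((t - 1) / (Real.sqrt (1 + (1 - t) ^ 2) + 1)) := by
    gcongr
  have h2 : 8 / 5 * ((t - 1) / (Real.sqrt (1 + (1 - t) ^ 2) + 1)) ≤
      2 * (t - 1) / (t - 1 + 2) := by
    rw [← mul_div_assoc, div_le_div_iff₀ (by positivity) (by positivity)]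
    nlinarith
  linarith

lemma deriv_klGap_neg {β t : ℝ} (hβ1 : β ≤ 8 / 5) (ht0 : 0 < t) (ht : t < 1) :
    Real.log t - β * ((t - 1) / (Real.sqrt (1 + (1 - t) ^ 2) + 1)) < 0 := by
  have hlog := Real.log_le_sub_one_of_pos ht0
  have hs : 1 ≤ Real.sqrt (1 + (1 - t) ^ 2) := by
    apply Real.le_sqrt_of_sq_le
    nlinarith [sq_nonneg (1 - t)]
  have hu : 0 < 1 - t := sub_pos.2 ht
  have h1 : (1 - t) / (Real.sqrt (1 + (1 - t) ^ 2) + 1) ≤ (1 - t) / 2 := by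
    gcongr
    linarith
  have h2 : β * ((1 - t) / (Real.sqrt (1 + (1 - t) ^ 2) + 1)) ≤
      8 / 5 * ((1 - t) / (Real.sqrt (1 + (1 - t) ^ 2) + 1)) := by
    gcongr
  have h3 : (t - 1) / (Real.sqrt (1 + (1 - t) ^ 2) + 1) =
      -((1 - t) / (Real.sqrt (1 + (1 - t) ^ 2) + 1)) := by
    rw [← neg_div, neg_sub]
  rw [h3]
  linarith

lemma klGap_pos {β t : ℝ} (hβ1 : β ≤ 8 / 5) (ht : 0 ≤ t) (ht1 : t ≠ 1) : 0 < klGap β t := by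
  rw [← klGap_one β]
  rcases lt_or_gt_of_ne ht1 with h | h
  · have hanti : StrictAntiOn (klGap β) (Set.Icc 0 1) := by
      refine strictAntiOn_of_deriv_neg (convex_Icc 0 1) (continuous_klGap β).continuousOn ?_
      intro x hx
      rw [interior_Icc] at hx
      rw [(hasDerivAt_klGap β hx.1).deriv]
      exact deriv_klGap_neg hβ1 hx.1 hx.2
    exact hanti ⟨ht, h.le⟩ ⟨zero_le_one, le_rfl⟩ h
  · have hmono : StrictMonoOn (klGap β) (Set.Ici 1) := by
      refine strictMonoOn_of_deriv_pos (convex_Ici 1) (continuous_klGap β).continuousOn ?_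
      intro x hx
      rw [interior_Ici] at hx
      rw [(hasDerivAt_klGap β (zero_lt_one.trans hx)).deriv]
      exact deriv_klGap_pos hβ1 hx
    exact hmono Set.self_mem_Ici h.le h

lemma phiOneR_eq (t : ℝ) : phiOneR t = t * Real.log t + 1 - t := by
  unfold phiOneR
  split_ifs with h <;> simp [h]

lemma phiABC_self_eq {β t : ℝ} (c : ℝ) (hβ : β ≠ 0) (ht : t ≠ 1) :
    phiABC β β c t = c * (β * (Real.sqrt (1 + (1 - t) ^ 2) - 1 -
      Real.log ((Real.sqrt (1 + (1 - t) ^ 2) + 1) / 2))) := by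
  have hu : 1 - t ≠ 0 := sub_ne_zero.2 ht.symm
  have hmul : β ^ 2 * ((1 - t) / β) ^ 2 = (1 - t) ^ 2 := by field_simp
  have hsq : Real.sqrt (1 + (1 - t) ^ 2) ^ 2 = 1 + (1 - t) ^ 2 := Real.sq_sqrt (by positivity)
  have harg : 2 * (Real.sqrt (1 + (1 - t) ^ 2) - 1) / (1 - t) ^ 2 =
      ((Real.sqrt (1 + (1 - t) ^ 2) + 1) / 2)⁻¹ := by
    have h0 := Real.sqrt_nonneg (1 + (1 - t) ^ 2)
    rw [inv_div, div_eq_div_iff (by positivity) (by positivity)]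
    linear_combination 2 * hsq
  rw [phiABC, if_neg ht, hmul, harg, Real.log_inv]
  ring

/-- bound `brostu5:fo.boundPOWdivmiss.altern2`: for all
`γ ∈ (1,∞)`, `β ∈ (0, 8/5]`, `c̃ ∈ (0,∞)` and all `t ∈ [0,∞)`, one has
`φ_{β,β,c̃/γ}(t) ≤ (c̃/γ)·φ_1(t)`, with equality if and only if `t = 1`. -/
theorem statement7 (γ β c : ℝ) (hγ : 1 < γ) (hβ0 : 0 < β) (hβ1 : β ≤ 8 / 5)
    (hc : 0 < c) (t : ℝ) (ht : 0 ≤ t) :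
    phiABC β β (c / γ) t ≤ (c / γ) * phiOneR t ∧
      (phiABC β β (c / γ) t = (c / γ) * phiOneR t ↔ t = 1) := by
  rcases eq_or_ne t 1 with rfl | h1
  · simp [phiABC, phiOneR]
  · have hpos : 0 < c / γ * klGap β t :=
      mul_pos (div_pos hc (zero_lt_one.trans hγ)) (klGap_pos hβ1 ht h1)
    have hlt : phiABC β β (c / γ) t < c / γ * phiOneR t := by
      rw [phiABC_self_eq _ hβ0.ne' h1, phiOneR_eq]
      rw [klGap, mul_sub] at hpos
      linarith
    exact ⟨hlt.le, fun h => absurd h hlt.ne, fun h => absurd h h1⟩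

end BareSim
end
end

section
/- Let A > 0, P ∈ ℝ^K with all p_k > 0, c̃ > 0, Q** ∈ ℝ^K with all q**_k > 0, and Q ∈ A·𝕊^K. Then inf_{m≠0} D^{SBD}_{c̃·φ_1,P}(m·Q, Q**) = F̆_{1,c̃,A,M_{Q**}}( D^{SBD}_{c̃·φ_1,P}(Q, Q**) ), where F̆_{1,c̃,A,M}(x) := c̃·( M − A·exp( M/A − 1 − x/(A·c̃) ) ) is strictly increasing on ℝ with strictly increasing inverse F̆^{←}_{1,c̃,A,M}(z) = c̃·( M − A − A·[ log(M − z/c̃) − log A ] ) for z < c̃·M. -/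
open scoped BigOperators ENNReal Pointwise

noncomputable section

namespace BareSim

/-- The Kullback–Leibler generator `φ_1 : ℝ → [0,∞]`:
`φ_1(t) = t·log t + 1 − t` for `t ≥ 0` (with `0·log 0 := 0`), `+∞` for `t < 0`. -/
def phiOneE (t : ℝ) : ℝ≥0∞ :=
  if 0 ≤ t then ENNReal.ofReal (t * Real.log t + 1 - t) else ⊤

/-- The scaled Bregman distance `D^{SBD}_{c̃·φ_1,P}(Q,Q**)` with generator `c̃·φ_1`
and scaling vector `P` (derivative `φ_1'(t) = log t`). -/
def DSBDone (K : ℕ) (c : ℝ) (p Qs Q : Fin K → ℝ) : EReal :=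
  ((c : ℝ) : EReal) * ∑ k, ((p k : ℝ) : EReal) *
    ((phiOneE (Q k / p k) : EReal) - (phiOneE (Qs k / p k) : EReal)
      - ((Real.log (Qs k / p k) * (Q k / p k - Qs k / p k) : ℝ) : EReal))

/-- The function `F̆_{1,c̃,A,M}(x) = c̃·(M − A·exp(M/A − 1 − x/(A·c̃)))`. -/
def Fbreve1 (c A M x : ℝ) : ℝ := c * (M - A * Real.exp (M / A - 1 - x / (A * c)))

/-- The inverse `F̆^{←}_{1,c̃,A,M}(z) = c̃·(M − A − A·(log(M − z/c̃) − log A))`. -/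
def Fbreve1inv (c A M z : ℝ) : ℝ :=
  c * (M - A - A * (Real.log (M - z / c) - Real.log A))

theorem coe_phiOneE_of_nonneg {t : ℝ} (ht : 0 ≤ t) :
    (phiOneE t : EReal) = ((t * Real.log t + 1 - t : ℝ) : EReal) := by
  have h : 0 ≤ t * Real.log t + 1 - t := by
    rcases ht.eq_or_lt with rfl | h0
    · simp
    · have h1 := mul_le_mul_of_nonneg_left (Real.one_sub_inv_le_log_of_pos h0) ht
      rw [mul_sub, mul_inv_cancel₀ h0.ne'] at h1
      linarith
  rw [phiOneE, if_pos ht, EReal.coe_ennreal_ofReal, max_eq_left h]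

theorem coe_phiOneE_of_neg {t : ℝ} (ht : t < 0) : (phiOneE t : EReal) = ⊤ := by
  rw [phiOneE, if_neg ht.not_ge, EReal.coe_ennreal_top]

theorem EReal_coe_sum {ι : Type*} (s : Finset ι) (f : ι → ℝ) :
    ((∑ i ∈ s, f i : ℝ) : EReal) = ∑ i ∈ s, (f i : EReal) :=
  map_sum (⟨⟨Real.toEReal, EReal.coe_zero⟩, EReal.coe_add⟩ : ℝ →+ EReal) f s

theorem EReal_sum_ne_bot {ι : Type*} (s : Finset ι) (f : ι → EReal)
    (hf : ∀ i ∈ s, f i ≠ ⊥) : ∑ i ∈ s, f i ≠ ⊥ :=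
  Finset.sum_induction f (· ≠ ⊥) (fun _ _ ha hb => EReal.add_ne_bot_iff.2 ⟨ha, hb⟩)
    EReal.zero_ne_bot hf

/-- The scaled Bregman distance of `m • Q` to `Qs` for `m > 0`, with the relative entropy
of `Q` factored out. -/
theorem DSBDone_smul_of_pos {K : ℕ} {c : ℝ} {p Qs Q : Fin K → ℝ} (hp : ∀ k, 0 < p k)
    (hQs : ∀ k, 0 < Qs k) (hQ : ∀ k, 0 ≤ Q k) {m : ℝ} (hm : 0 < m) :
    DSBDone K c p Qs (m • Q) =
      ((c * (m * ∑ k, Q k * Real.log (Q k / Qs k) + m * Real.log m * ∑ k, Q k - m * ∑ k, Q k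
        + ∑ k, Qs k) : ℝ) : EReal) := by
  have hterm : ∀ k, ((p k : ℝ) : EReal) *
      ((phiOneE ((m • Q) k / p k) : EReal) - (phiOneE (Qs k / p k) : EReal)
        - ((Real.log (Qs k / p k) * ((m • Q) k / p k - Qs k / p k) : ℝ) : EReal)) =
      ((m * (Q k * Real.log (Q k / Qs k)) + m * Real.log m * Q k - m * Q k + Qs k : ℝ) :
        EReal) := by
    intro k
    have hpk := hp k
    have hsk := hQs k
    rw [Pi.smul_apply, smul_eq_mul,
      coe_phiOneE_of_nonneg (div_nonneg (mul_nonneg hm.le (hQ k)) hpk.le),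
      coe_phiOneE_of_nonneg (div_pos hsk hpk).le, ← EReal.coe_sub, ← EReal.coe_sub,
      ← EReal.coe_mul, EReal.coe_eq_coe_iff]
    rcases (hQ k).eq_or_lt with h0 | h0
    · rw [← h0]
      simp only [mul_zero, zero_div, zero_mul]
      field_simp
      ring
    · rw [Real.log_div (mul_pos hm h0).ne' hpk.ne', Real.log_mul hm.ne' h0.ne',
        Real.log_div hsk.ne' hpk.ne', Real.log_div h0.ne' hsk.ne']
      field_simp
      ring
  rw [DSBDone, Finset.sum_congr rfl fun k _ => hterm k, ← EReal_coe_sum, ← EReal.coe_mul]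
  simp only [Finset.sum_add_distrib, Finset.sum_sub_distrib, Finset.mul_sum]

theorem DSBDone_eq_top {K : ℕ} {c : ℝ} (hc : 0 < c) {p Qs Q : Fin K → ℝ} (hp : ∀ k, 0 < p k)
    (hQs : ∀ k, 0 < Qs k) {j : Fin K} (hj : Q j < 0) : DSBDone K c p Qs Q = ⊤ := by
  have htop : ∀ k, Q k < 0 → ((p k : ℝ) : EReal) *
      ((phiOneE (Q k / p k) : EReal) - (phiOneE (Qs k / p k) : EReal)
        - ((Real.log (Qs k / p k) * (Q k / p k - Qs k / p k) : ℝ) : EReal)) = ⊤ := by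
    intro k hk
    rw [coe_phiOneE_of_neg (div_neg_of_neg_of_pos hk (hp k)),
      coe_phiOneE_of_nonneg (div_pos (hQs k) (hp k)).le, EReal.top_sub_coe, EReal.top_sub_coe,
      EReal.coe_mul_top_of_pos (hp k)]
  rw [DSBDone, ← Finset.add_sum_erase _ _ (Finset.mem_univ j), htop j hj,
    EReal.top_add_of_ne_bot, EReal.coe_mul_top_of_pos hc]
  refine EReal_sum_ne_bot _ _ fun k _ => ?_
  rcases lt_or_ge (Q k) 0 with hk | hk
  · rw [htop k hk]
    exact top_ne_bot
  · rw [coe_phiOneE_of_nonneg (div_nonneg hk (hp k).le),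
      coe_phiOneE_of_nonneg (div_pos (hQs k) (hp k)).le, ← EReal.coe_sub, ← EReal.coe_sub,
      ← EReal.coe_mul]
    exact EReal.coe_ne_bot _

theorem neg_mul_exp_le {A m : ℝ} (hA : 0 < A) (hm : 0 < m) (S : ℝ) :
    -(A * Real.exp (-S / A)) ≤ m * S + m * Real.log m * A - m * A := by
  have h := Real.add_one_le_exp (-S / A - Real.log m)
  rw [Real.exp_sub, Real.exp_log hm, le_div_iff₀ hm] at h
  have h2 := mul_le_mul_of_nonneg_left h hA.le
  have h3 : A * ((-S / A - Real.log m + 1) * m) = -(m * S + m * Real.log m * A - m * A) := by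
    field_simp
    ring
  linarith

theorem Fbreve1_strictMono {c A : ℝ} (hc : 0 < c) (hA : 0 < A) (M : ℝ) :
    StrictMono (Fbreve1 c A M) := by
  intro x y hxy
  unfold Fbreve1
  gcongr

theorem Fbreve1_lt {c A : ℝ} (hc : 0 < c) (hA : 0 < A) (M x : ℝ) :
    Fbreve1 c A M x < c * M :=
  mul_lt_mul_of_pos_left (sub_lt_self _ (mul_pos hA (Real.exp_pos _))) hc

theorem Fbreve1inv_Fbreve1 {c A : ℝ} (hc : 0 < c) (hA : 0 < A) (M x : ℝ) :
    Fbreve1inv c A M (Fbreve1 c A M x) = x := by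
  unfold Fbreve1 Fbreve1inv
  rw [mul_div_cancel_left₀ _ hc.ne', sub_sub_cancel, Real.log_mul hA.ne' (Real.exp_ne_zero _),
    Real.log_exp]
  field_simp
  ring

theorem Fbreve1_Fbreve1inv {c A M z : ℝ} (hc : 0 < c) (hA : 0 < A) (hz : z < c * M) :
    Fbreve1 c A M (Fbreve1inv c A M z) = z := by
  have hpos : 0 < M - z / c := by
    rw [sub_pos, div_lt_iff₀ hc]
    linarith
  unfold Fbreve1 Fbreve1inv
  have h : M / A - 1 - c * (M - A - A * (Real.log (M - z / c) - Real.log A)) / (A * c)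
      = Real.log (M - z / c) - Real.log A := by
    generalize Real.log (M - z / c) = l
    field_simp
    ring
  rw [h, Real.exp_sub, Real.exp_log hpos, Real.exp_log hA]
  field_simp
  ring

theorem Fbreve1inv_strictMonoOn {c A : ℝ} (hc : 0 < c) (hA : 0 < A) (M : ℝ) :
    StrictMonoOn (Fbreve1inv c A M) (Set.Iio (c * M)) := by
  intro x hx y hy hxy
  rwa [← (Fbreve1_strictMono hc hA M).lt_iff_lt, Fbreve1_Fbreve1inv hc hA hx,
    Fbreve1_Fbreve1inv hc hA hy]

theorem iInf_DSBDone_smul {K : ℕ} {c : ℝ} (hc : 0 < c) {p Qs Q : Fin K → ℝ}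
    (hp : ∀ k, 0 < p k) (hQs : ∀ k, 0 < Qs k) (hQ : ∀ k, 0 ≤ Q k) (hQpos : 0 < ∑ k, Q k) :
    (⨅ (m : ℝ) (_ : m ≠ 0), DSBDone K c p Qs (m • Q)) =
      ((Fbreve1 c (∑ k, Q k) (∑ k, Qs k) (DSBDone K c p Qs Q).toReal : ℝ) : EReal) := by
  have hD := fun m hm => DSBDone_smul_of_pos (c := c) (m := m) hp hQs hQ hm
  have hD1 := hD 1 one_pos
  rw [one_smul] at hD1
  obtain ⟨j, -, hj⟩ := Finset.exists_lt_of_sum_lt (s := Finset.univ) (f := fun _ => (0 : ℝ))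
    (g := Q) (by simpa using hQpos)
  rw [hD1, EReal.toReal_coe]
  generalize ∑ k, Q k = A at *
  generalize ∑ k, Q k * Real.log (Q k / Qs k) = S at *
  generalize ∑ k, Qs k = M at *
  have hF : Fbreve1 c A M (c * (1 * S + 1 * Real.log 1 * A - 1 * A + M))
      = c * (M - A * Real.exp (-S / A)) := by
    rw [Fbreve1, Real.log_one]
    congr 4
    field_simp
    ring
  rw [hF]
  apply le_antisymm
  · refine (iInf₂_le (Real.exp (-S / A)) (Real.exp_ne_zero _)).trans_eq ?_
    rw [hD _ (Real.exp_pos _), Real.log_exp]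
    congr 2
    field_simp
    ring
  · refine le_iInf₂ fun m hm => ?_
    rcases hm.lt_or_gt with hm | hm
    · rw [DSBDone_eq_top (Q := m • Q) hc hp hQs (j := j) (mul_neg_of_neg_of_pos hm hj)]
      exact le_top
    · rw [hD m hm, EReal.coe_le_coe_iff]
      have := neg_mul_exp_le hQpos hm S
      gcongr
      linarith

/-- Theorem `brostu5:thm.divnormW.new.SBD`(b):
`inf_{m≠0} D^{SBD}_{c̃·φ_1,P}(m·Q,Q**) = F̆_{1,c̃,A,M_{Q**}}(D^{SBD}_{c̃·φ_1,P}(Q,Q**))`,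
where `F̆_{1,c̃,A,M}` is strictly increasing on `ℝ` with strictly increasing inverse
`F̆^{←}_{1,c̃,A,M}(z) = c̃·(M − A − A·(log(M − z/c̃) − log A))` for `z < c̃·M`. -/
theorem statement14
    (K : ℕ) (A : ℝ) (hA : 0 < A) (p : Fin K → ℝ) (hp : ∀ k, 0 < p k)
    (c : ℝ) (hc : 0 < c)
    (Qs : Fin K → ℝ) (hQs : ∀ k, 0 < Qs k)
    (Q : Fin K → ℝ) (hQ : Q ∈ A • stdSimplex ℝ (Fin K)) :
    (⨅ (m : ℝ) (_ : m ≠ 0), DSBDone K c p Qs (m • Q))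
        = ((Fbreve1 c A (∑ k, Qs k) ((DSBDone K c p Qs Q).toReal) : ℝ) : EReal) ∧
      StrictMono (Fbreve1 c A (∑ k, Qs k)) ∧
      StrictMonoOn (Fbreve1inv c A (∑ k, Qs k)) (Set.Iio (c * ∑ k, Qs k)) ∧
      (∀ x : ℝ, Fbreve1 c A (∑ k, Qs k) x < c * ∑ k, Qs k ∧
        Fbreve1inv c A (∑ k, Qs k) (Fbreve1 c A (∑ k, Qs k) x) = x) ∧
      ∀ z < c * ∑ k, Qs k, Fbreve1 c A (∑ k, Qs k) (Fbreve1inv c A (∑ k, Qs k) z) = z := by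
  obtain ⟨R, ⟨hR, hR1⟩, rfl⟩ := Set.mem_smul_set.1 hQ
  have hsum : ∑ k, (A • R) k = A := by
    simp only [Pi.smul_apply, smul_eq_mul, ← Finset.mul_sum, hR1, mul_one]
  refine ⟨?_, Fbreve1_strictMono hc hA _, Fbreve1inv_strictMonoOn hc hA _,
    fun x => ⟨Fbreve1_lt hc hA _ x, Fbreve1inv_Fbreve1 hc hA _ x⟩,
    fun z hz => Fbreve1_Fbreve1inv hc hA hz⟩
  have h := iInf_DSBDone_smul hc hp hQs (Q := A • R) (fun k => mul_nonneg hA.le (hR k))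
    (hsum.symm ▸ hA)
  rwa [hsum] at h

end BareSim
end
end
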